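/- arXiv:2604.12767 — 3 statements merged into one kernel-verified Lean document; each statement's English description precedes it below -/
import Mathlib

section
/- The softmax map is (1/2)-Lipschitz from (ℝ^L, ℓ1) to (ℝ^L, ℓ1): for any u, v ∈ ℝ^L, ‖softmax(u) − softmax(v)‖_1 ≤ (1/2) ‖u − v‖_1. -/
/-- Componentwise softmax of a vector in `ℝ^L`. -/
noncomputable def softmax {L : ℕ} (u : Fin L → ℝ) : Fin L → ℝ :=
  fun l => Real.exp (u l) / ∑ k, Real.exp (u k)

/-- For nonnegative weights `w` and coefficients `s` of absolute value at most one, the `s`-weighted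
column `k` of the (unnormalized) softmax Jacobian is at most half the squared total weight. -/
lemma abs_mul_sub_weighted_sum_le {ι : Type*} [Fintype ι] (w s : ι → ℝ)
    (hw : ∀ i, 0 ≤ w i) (hs : ∀ i, |s i| ≤ 1) (k : ι) :
    |w k * (s k * ∑ i, w i - ∑ i, s i * w i)| ≤ (1 / 2) * (∑ i, w i) ^ 2 := by
  classical
  have hrest : |∑ i ∈ Finset.univ.erase k, s i * w i| ≤ ∑ i ∈ Finset.univ.erase k, w i := by
    refine (Finset.abs_sum_le_sum_abs _ _).trans (Finset.sum_le_sum fun i _ => ?_)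
    rw [abs_mul, abs_of_nonneg (hw i)]
    exact mul_le_of_le_one_left (hw i) (hs i)
  have hnonneg : 0 ≤ ∑ i ∈ Finset.univ.erase k, w i := Finset.sum_nonneg fun i _ => hw i
  rw [← Finset.add_sum_erase _ w (Finset.mem_univ k),
    ← Finset.add_sum_erase _ (fun i => s i * w i) (Finset.mem_univ k)]
  set R := ∑ i ∈ Finset.univ.erase k, w i
  set N := ∑ i ∈ Finset.univ.erase k, s i * w i
  have hdev : |s k * R - N| ≤ 2 * R := by
    have hsR : |s k * R| ≤ R := by
      rw [abs_mul, abs_of_nonneg hnonneg]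
      exact mul_le_of_le_one_left hnonneg (hs k)
    linarith [abs_sub (s k * R) N]
  calc |w k * (s k * (w k + R) - (s k * w k + N))| = w k * |s k * R - N| := by
        rw [show s k * (w k + R) - (s k * w k + N) = s k * R - N by ring, abs_mul,
          abs_of_nonneg (hw k)]
    _ ≤ w k * (2 * R) := mul_le_mul_of_nonneg_left hdev (hw k)
    _ ≤ (1 / 2) * (w k + R) ^ 2 := by nlinarith [sq_nonneg (w k - R)]

/-- Pairing the softmax with a vector of sup norm at most one is (1/2)-Lipschitz in ℓ1. -/
lemma abs_sum_mul_softmax_sub_le {L : ℕ} (s u v : Fin L → ℝ) (hs : ∀ i, |s i| ≤ 1) :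
    |∑ l, s l * softmax u l - ∑ l, s l * softmax v l| ≤ (1 / 2) * ∑ l, |u l - v l| := by
  rcases isEmpty_or_nonempty (Fin L) with hL | hL
  · simp
  let e : Fin L → ℝ → ℝ := fun l t => Real.exp (v l + t * (u l - v l))
  have he (l : Fin L) (t : ℝ) : HasDerivAt (e l) (e l t * (u l - v l)) t := by
    simpa using (((hasDerivAt_id t).mul_const (u l - v l)).const_add (v l)).exp
  have hZ (t : ℝ) : 0 < ∑ l, e l t :=
    Finset.sum_pos (fun l _ => Real.exp_pos _) Finset.univ_nonempty
  have hderiv (t : ℝ) := (HasDerivAt.fun_sum (u := Finset.univ)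
    fun l _ => (he l t).const_mul (s l)).fun_div
      (HasDerivAt.fun_sum (u := Finset.univ) fun l _ => he l t) (hZ t).ne'
  have hmvt := norm_image_sub_le_of_norm_deriv_le_segment_01'
    (C := (1 / 2) * ∑ l, |u l - v l|) (fun t _ => (hderiv t).hasDerivWithinAt) (fun t _ => by
      rw [Real.norm_eq_abs, abs_div, abs_of_pos (pow_pos (hZ t) 2), div_le_iff₀ (pow_pos (hZ t) 2)]
      have hsplit : (∑ l, s l * (e l t * (u l - v l))) * ∑ l, e l t
          - (∑ l, s l * e l t) * ∑ l, e l t * (u l - v l)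
          = ∑ k, (e k t * (s k * ∑ l, e l t - ∑ l, s l * e l t)) * (u k - v k) := by
        rw [Finset.sum_mul, Finset.mul_sum, ← Finset.sum_sub_distrib]
        exact Finset.sum_congr rfl fun k _ => by ring
      rw [hsplit, mul_right_comm, Finset.mul_sum]
      refine (Finset.abs_sum_le_sum_abs _ _).trans (Finset.sum_le_sum fun k _ => ?_)
      rw [abs_mul]
      exact mul_le_mul_of_nonneg_right (abs_mul_sub_weighted_sum_le (fun l => e l t) s
        (fun l => (Real.exp_pos _).le) hs k) (abs_nonneg _))
  simpa [e, softmax, ← mul_div_assoc, ← Finset.sum_div] using hmvt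

/-- **Softmax is (1/2)-Lipschitz in ℓ1.** For any `u, v ∈ ℝ^L`,
`‖softmax u − softmax v‖₁ ≤ (1/2) ‖u − v‖₁`. -/
theorem softmax_l1_lipschitz {L : ℕ} (u v : Fin L → ℝ) :
    ∑ l, |softmax u l - softmax v l| ≤ (1 / 2) * ∑ l, |u l - v l| := by
  let s : Fin L → ℝ := fun l => if 0 ≤ softmax u l - softmax v l then 1 else -1
  have hs (l : Fin L) : |s l| ≤ 1 := by
    dsimp only [s]
    split_ifs <;> simp
  have habs (l : Fin L) :
      |softmax u l - softmax v l| = s l * softmax u l - s l * softmax v l := by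
    dsimp only [s]
    split_ifs with h
    · rw [abs_of_nonneg h]; ring
    · rw [abs_of_neg (not_le.mp h)]; ring
  calc ∑ l, |softmax u l - softmax v l|
      = ∑ l, s l * softmax u l - ∑ l, s l * softmax v l := by
        simp_rw [habs, Finset.sum_sub_distrib]
    _ ≤ _ := (le_abs_self _).trans (abs_sum_mul_softmax_sub_le s u v hs)
end

section
/- For any temperature τ > 0 and any w, w' ∈ ℝ^L, ‖softmax(τ w) − softmax(τ w')‖_1 ≤ (τ/2) ‖w − w'‖_1. -/
theorem abs_mul_sum_sub_sum_mul_le {ι : Type*} [Fintype ι] (e s : ι → ℝ)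
    (he : ∀ i, 0 ≤ e i) (hs : ∀ i, |s i| ≤ 1) (k : ι) :
    |s k * ∑ i, e i - ∑ i, s i * e i| ≤ 2 * (∑ i, e i - e k) := by
  classical
  have h1 : s k * ∑ i, e i - ∑ i, s i * e i = ∑ i ∈ Finset.univ.erase k, (s k - s i) * e i := by
    rw [Finset.sum_erase _ (by simp), Finset.mul_sum, ← Finset.sum_sub_distrib]
    exact Finset.sum_congr rfl fun i _ => by ring
  have h2 : ∑ i, e i - e k = ∑ i ∈ Finset.univ.erase k, e i := by
    rw [← Finset.sum_erase_add _ _ (Finset.mem_univ k)]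
    ring
  rw [h1, h2, Finset.mul_sum]
  refine (Finset.abs_sum_le_sum_abs _ _).trans (Finset.sum_le_sum fun i _ => ?_)
  rw [abs_mul, abs_of_nonneg (he i)]
  refine mul_le_mul_of_nonneg_right ?_ (he i)
  linarith [abs_sub (s k) (s i), hs k, hs i]

theorem abs_weighted_covariance_le {ι : Type*} [Fintype ι] [Nonempty ι] (e s d : ι → ℝ)
    (he : ∀ i, 0 < e i) (hs : ∀ i, |s i| ≤ 1) :
    |((∑ i, s i * (e i * d i)) * ∑ i, e i - (∑ i, s i * e i) * ∑ i, e i * d i) /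
      (∑ i, e i) ^ 2| ≤ 1 / 2 * ∑ i, |d i| := by
  have hZ : 0 < ∑ i, e i := Finset.sum_pos (fun i _ => he i) Finset.univ_nonempty
  have h1 : (∑ i, s i * (e i * d i)) * ∑ i, e i - (∑ i, s i * e i) * ∑ i, e i * d i
      = ∑ k, d k * (e k * (s k * ∑ i, e i - ∑ i, s i * e i)) := by
    rw [Finset.sum_mul, Finset.mul_sum, ← Finset.sum_sub_distrib]
    exact Finset.sum_congr rfl fun i _ => by ring
  rw [h1, abs_div, abs_of_pos (pow_pos hZ 2), div_le_iff₀ (pow_pos hZ 2), Finset.mul_sum,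
    Finset.sum_mul]
  refine (Finset.abs_sum_le_sum_abs _ _).trans (Finset.sum_le_sum fun k _ => ?_)
  rw [abs_mul, abs_mul, abs_of_pos (he k)]
  have h2 := mul_le_mul_of_nonneg_left
    (abs_mul_sum_sub_sum_mul_le e s (fun i => (he i).le) hs k) (he k).le
  have h3 : e k * |s k * ∑ i, e i - ∑ i, s i * e i| ≤ 1 / 2 * (∑ i, e i) ^ 2 := by
    nlinarith [sq_nonneg (∑ i, e i - 2 * e k)]
  calc _ ≤ |d k| * (1 / 2 * (∑ i, e i) ^ 2) := mul_le_mul_of_nonneg_left h3 (abs_nonneg _)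
    _ = _ := by ring

/-- Softmax is `1/2`-Lipschitz for the `ℓ¹` norm. -/
theorem sum_abs_softmax_sub_le {L : ℕ} (u v : Fin L → ℝ) :
    ∑ l, |softmax u l - softmax v l| ≤ 1 / 2 * ∑ l, |u l - v l| := by
  rcases isEmpty_or_nonempty (Fin L) with _ | _
  · simp
  let s : Fin L → ℝ := fun l => SignType.sign (softmax u l - softmax v l)
  have hs : ∀ i, |s i| ≤ 1 := fun i => by
    rcases lt_trichotomy (softmax u i - softmax v i) 0 with h | h | h <;> simp [s, h]
  let e : ℝ → Fin L → ℝ := fun t l => Real.exp (v l + t * (u l - v l))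
  have he : ∀ t l, 0 < e t l := fun t l => Real.exp_pos _
  have hZ : ∀ t, ∑ l, e t l ≠ 0 := fun t =>
    (Finset.sum_pos (fun i _ => he t i) Finset.univ_nonempty).ne'
  have hde : ∀ t l, HasDerivAt (fun x => e x l) (e t l * (u l - v l)) t := fun t l => by
    simpa using (((hasDerivAt_id t).mul_const (u l - v l)).const_add (v l)).exp
  have hderiv : ∀ t, HasDerivAt (fun x => (∑ l, s l * e x l) / ∑ l, e x l) _ t := fun t =>
    (HasDerivAt.fun_sum fun l _ => (hde t l).const_mul (s l)).fun_div
      (HasDerivAt.fun_sum fun l _ => hde t l) (hZ t)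
  obtain ⟨t, -, ht⟩ := exists_hasDerivAt_eq_slope _ _ (zero_lt_one (α := ℝ))
    (fun t _ => (hderiv t).continuousAt.continuousWithinAt) fun t _ => hderiv t
  have hbound := abs_weighted_covariance_le (e t) s (fun l => u l - v l) (he t) hs
  rw [ht] at hbound
  refine le_trans (le_of_eq ?_) ((le_abs_self _).trans hbound)
  simp only [e, one_mul, zero_mul, add_zero, sub_zero, div_one, add_sub_cancel]
  rw [Finset.sum_div, Finset.sum_div, ← Finset.sum_sub_distrib]
  refine Finset.sum_congr rfl fun l _ => ?_
  rw [← sign_mul_self]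
  simp only [s, softmax]
  ring

/-- **Temperature-scaled softmax Lipschitz bound.** For any temperature `τ > 0` and any
`w, w' ∈ ℝ^L`, `‖softmax (τ w) − softmax (τ w')‖₁ ≤ (τ/2) ‖w − w'‖₁`. -/
theorem softmax_temp_l1_lipschitz {L : ℕ} (τ : ℝ) (hτ : 0 < τ) (w w' : Fin L → ℝ) :
    ∑ l, |softmax (τ • w) l - softmax (τ • w') l| ≤ (τ / 2) * ∑ l, |w l - w' l| := by
  refine (sum_abs_softmax_sub_le _ _).trans (le_of_eq ?_)
  simp only [Pi.smul_apply, smul_eq_mul, ← mul_sub, abs_mul, abs_of_pos hτ, ← Finset.mul_sum]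
  ring
end

section
/- Let z^{(1)}, …, z^{(L)} ∈ ℝ^{d} satisfy ‖z^{(l)}‖_2 ≤ B for all l, with B > 0, let τ > 0, and for w ∈ ℝ^L define z̄(w) = Σ_{l=1}^L softmax(τ w)_l · z^{(l)}. Then for any w, w' ∈ ℝ^L, ‖z̄(w) − z̄(w')‖_2 ≤ (B τ / 2) ‖w − w'‖_1. -/
theorem softmax_nonneg {L : ℕ} (u : Fin L → ℝ) (l : Fin L) : 0 ≤ softmax u l := by
  unfold softmax
  positivity

theorem sum_exp_pos {L : ℕ} (u : Fin L → ℝ) (l : Fin L) : 0 < ∑ k, Real.exp (u k) :=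
  Finset.sum_pos (fun k _ => Real.exp_pos (u k)) ⟨l, Finset.mem_univ l⟩

theorem sum_softmax {L : ℕ} (u : Fin L → ℝ) (l : Fin L) : ∑ k, softmax u k = 1 := by
  simp only [softmax, ← Finset.sum_div]
  exact div_self (sum_exp_pos u l).ne'

theorem hasDerivAt_softmax_line {L : ℕ} (u v : Fin L → ℝ) (l : Fin L) (t : ℝ) :
    HasDerivAt (fun s : ℝ => softmax (u + s • v) l)
      (softmax (u + t • v) l * (v l - ∑ k, softmax (u + t • v) k * v k)) t := by
  have hexp (k : Fin L) : HasDerivAt (fun s : ℝ => Real.exp ((u + s • v) k))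
      (Real.exp ((u + t • v) k) * v k) t := by
    simpa using (((hasDerivAt_id t).mul_const (v k)).const_add (u k)).exp
  have hS : (∑ k, Real.exp ((u + t • v) k)) ≠ 0 := (sum_exp_pos _ l).ne'
  have hsum : HasDerivAt (fun s : ℝ => ∑ k, Real.exp ((u + s • v) k))
      (∑ k, Real.exp ((u + t • v) k) * v k) t := HasDerivAt.fun_sum fun k _ => hexp k
  refine ((hexp l).fun_div hsum hS).congr_deriv ?_
  simp only [softmax, div_mul_eq_mul_div, ← Finset.sum_div]
  field_simp

/-- A point of weight `p l` deviates from the weighted mean by at most `2 B (1 - p l)`. -/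
theorem norm_smul_sub_weighted_mean_le {ι E : Type*} [Fintype ι]
    [NormedAddCommGroup E] [NormedSpace ℝ E] {B : ℝ} {p : ι → ℝ} (hp : ∀ k, 0 ≤ p k)
    (hp1 : ∑ k, p k = 1) {z : ι → E} (hz : ∀ k, ‖z k‖ ≤ B) (l : ι) :
    ‖p l • (z l - ∑ k, p k • z k)‖ ≤ B / 2 := by
  classical
  have hB : 0 ≤ B := (norm_nonneg _).trans (hz l)
  have hrest : ∑ k ∈ Finset.univ.erase l, p k = 1 - p l := by
    rw [← hp1, ← Finset.add_sum_erase _ _ (Finset.mem_univ l)]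
    ring
  have hle : 0 ≤ 1 - p l := hrest ▸ Finset.sum_nonneg fun k _ => hp k
  have hmean : z l - ∑ k, p k • z k
      = (1 - p l) • z l - ∑ k ∈ Finset.univ.erase l, p k • z k := by
    rw [← Finset.add_sum_erase _ _ (Finset.mem_univ l)]
    module
  have hothers : ‖∑ k ∈ Finset.univ.erase l, p k • z k‖ ≤ (1 - p l) * B := by
    rw [← hrest, Finset.sum_mul]
    refine norm_sum_le_of_le _ fun k _ => ?_
    rw [norm_smul, Real.norm_of_nonneg (hp k)]
    exact mul_le_mul_of_nonneg_left (hz k) (hp k)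
  have hself : ‖(1 - p l) • z l‖ ≤ (1 - p l) * B := by
    rw [norm_smul, Real.norm_of_nonneg hle]
    exact mul_le_mul_of_nonneg_left (hz l) hle
  rw [norm_smul, Real.norm_of_nonneg (hp l), hmean]
  calc p l * ‖(1 - p l) • z l - ∑ k ∈ Finset.univ.erase l, p k • z k‖
      ≤ p l * ((1 - p l) * B + (1 - p l) * B) :=
        mul_le_mul_of_nonneg_left ((norm_sub_le _ _).trans (add_le_add hself hothers)) (hp l)
    _ ≤ B / 2 := by nlinarith [mul_nonneg hB (sq_nonneg (2 * p l - 1))]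

theorem hasDerivAt_sum_softmax_smul_line {L : ℕ} {E : Type*} [NormedAddCommGroup E]
    [NormedSpace ℝ E] (u v : Fin L → ℝ) (z : Fin L → E) (t : ℝ) :
    HasDerivAt (fun s : ℝ => ∑ l, softmax (u + s • v) l • z l)
      (∑ l, v l • softmax (u + t • v) l • (z l - ∑ k, softmax (u + t • v) k • z k)) t := by
  refine (HasDerivAt.fun_sum fun l _ =>
    (hasDerivAt_softmax_line u v l t).smul_const (z l)).congr_deriv ?_
  set p := softmax (u + t • v)
  simp only [mul_sub, sub_smul, smul_sub, Finset.sum_sub_distrib, smul_smul]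
  congr 1
  · exact Finset.sum_congr rfl fun l _ => by rw [mul_comm]
  · rw [← Finset.sum_smul, Finset.smul_sum]
    refine Finset.sum_congr rfl fun l _ => ?_
    rw [smul_smul, mul_comm]
    simp only [mul_comm]

theorem norm_sum_softmax_smul_sub_le {L : ℕ} {E : Type*} [NormedAddCommGroup E]
    [NormedSpace ℝ E] {B : ℝ} {z : Fin L → E} (hz : ∀ l, ‖z l‖ ≤ B) (u u' : Fin L → ℝ) :
    ‖(∑ l, softmax u l • z l) - ∑ l, softmax u' l • z l‖ ≤ B / 2 * ∑ l, |u l - u' l| := by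
  have h := norm_image_sub_le_of_norm_deriv_le_segment_01'
    (fun t _ => (hasDerivAt_sum_softmax_smul_line u' (u - u') z t).hasDerivWithinAt)
    (C := B / 2 * ∑ l, |u l - u' l|) fun t _ => by
      rw [Finset.mul_sum]
      refine norm_sum_le_of_le _ fun l _ => ?_
      rw [norm_smul, Real.norm_eq_abs, Pi.sub_apply, mul_comm]
      exact mul_le_mul_of_nonneg_right (norm_smul_sub_weighted_mean_le
        (softmax_nonneg _) (sum_softmax _ l) hz l) (abs_nonneg _)
  simpa using h

/-- **Stability of fused tokens under routing-score perturbation.** With layer tokens of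
norm at most `B > 0` and fused token `z̄(w) = ∑ l, softmax(τ w)_l • z^{(l)}`, for any
`w, w'` we have `‖z̄(w) − z̄(w')‖₂ ≤ (B τ / 2) ‖w − w'‖₁`. -/
theorem fused_token_stability {L d : ℕ} (B : ℝ) (hB : 0 < B) (τ : ℝ) (hτ : 0 < τ)
    (z : Fin L → EuclideanSpace ℝ (Fin d)) (hz : ∀ l, ‖z l‖ ≤ B)
    (w w' : Fin L → ℝ) :
    ‖(∑ l, softmax (τ • w) l • z l) - ∑ l, softmax (τ • w') l • z l‖ ≤
      (B * τ / 2) * ∑ l, |w l - w' l| := by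
  refine (norm_sum_softmax_smul_sub_le hz (τ • w) (τ • w')).trans_eq ?_
  simp only [Pi.smul_apply, smul_eq_mul, ← mul_sub, abs_mul, abs_of_pos hτ, ← Finset.mul_sum]
  ring
end
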